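/- Let (Δ,δ) be a building of type (W,S) where W satisfies the nested condition relative to u ∈ S. Let C, D, E ∈ Δ and let φ, φ₁, φ₂ : W → Δ be isometries with φ(1) = D = φ₁(1), φ(w) = C, φ₁(w₁) = E, φ₂(1) = C, and φ₂(w₂) = E, for elements w, w₁, w₂ ∈ W. If there exist signs †, †' ∈ {+, −} such that w·H_u^† ⊊ H_u^+ and H_u^+ ⊊ w₁·H_u^{†'}, then H_u^† ⊊ w₂·H_u^{†'}. -/

import Mathlib

open Pointwise
open scoped Classical

variable {B : Type*} {W : Type*} [Group W] {M : CoxeterMatrix B}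

/-- The positive root `H_s^+` associated to the generator indexed by `i`:
elements `g` with `l(sg) > l(g)`. -/
def Hp (cs : CoxeterSystem M W) (i : B) : Set W :=
  {g : W | cs.length g < cs.length (cs.simple i * g)}

/-- The negative root `H_s^-`: elements `g` with `l(sg) < l(g)`. -/
def Hm (cs : CoxeterSystem M W) (i : B) : Set W :=
  {g : W | cs.length (cs.simple i * g) < cs.length g}

/-- `g` satisfies one of the six cases of the nested condition relative to `s`. -/
def NestedAt (cs : CoxeterSystem M W) (i : B) (g : W) : Prop :=
  g • Hp cs i = Hp cs i ∨ g • Hp cs i = Hm cs i ∨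
  g • Hp cs i ⊂ Hp cs i ∨ g • Hp cs i ⊂ Hm cs i ∨
  g • Hm cs i ⊂ Hp cs i ∨ g • Hm cs i ⊂ Hm cs i

/-- `W` satisfies the nested condition relative to the generator indexed by `i`. -/
def Nested (cs : CoxeterSystem M W) (i : B) : Prop := ∀ g : W, NestedAt cs i g

/-- The stabilizer `Stab_{H_s^+}` of the positive root. -/
def StabHp (cs : CoxeterSystem M W) (i : B) : Set W :=
  {g : W | g • Hp cs i = Hp cs i}

/-- The multiplier `m_W^s`. -/
noncomputable def mWs (cs : CoxeterSystem M W) (i : B) (g : W) : ℤ :=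
  if g ∈ Hp cs i then 1 else -1

/-- `(Δ, d)` is a building of type `(W,S)`: axioms (B1), (B2), (B3). -/
def IsBuilding (cs : CoxeterSystem M W) (Δ : Type*) (d : Δ → Δ → W) : Prop :=
  Nonempty Δ ∧
  (∀ C D : Δ, d C D = 1 ↔ C = D) ∧
  (∀ (C D E : Δ) (i : B), d E C = cs.simple i →
    (d E D = cs.simple i * d C D ∨ d E D = d C D) ∧
    (cs.length (d C D) < cs.length (cs.simple i * d C D) → d E D = cs.simple i * d C D)) ∧
  (∀ (C D : Δ) (i : B), ∃ E : Δ, d E C = cs.simple i ∧ d E D = cs.simple i * d C D)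

/-- `φ : W → Δ` is an isometry into the building. -/
def IsIsom {Δ : Type*} (d : Δ → Δ → W) (φ : W → Δ) : Prop :=
  ∀ a b : W, d (φ a) (φ b) = a⁻¹ * b

namespace CoxeterSystem

/-- The signed conjugation by a simple reflection: it conjugates the first component and
flips the sign exactly at the reflection itself. -/
noncomputable def signedConj (cs : CoxeterSystem M W) (i : B) : Function.End (W × ZMod 2) :=
  fun p => (cs.simple i * p.1 * cs.simple i, p.2 + if p.1 = cs.simple i then 1 else 0)

theorem signedConj_mul_pow_apply (cs : CoxeterSystem M W) (i j : B) (n : ℕ) (p : W × ZMod 2) :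
    ((cs.signedConj i * cs.signedConj j) ^ n) p =
      ((cs.simple i * cs.simple j) ^ n * p.1 * ((cs.simple i * cs.simple j) ^ n)⁻¹,
        p.2 + ∑ k ∈ Finset.range (2 * n),
          if p.1 = cs.simple j * (cs.simple i * cs.simple j) ^ k then 1 else 0) := by
  induction n with
  | zero => simp; rfl
  | succ n ih =>
    rw [pow_succ']
    change (cs.signedConj i * cs.signedConj j)
      (((cs.signedConj i * cs.signedConj j) ^ n) p) = _
    rw [ih]
    change cs.signedConj i (cs.signedConj j _) = _
    set a := cs.simple i with ha
    set b := cs.simple j with hb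
    have ha' : a⁻¹ = a := cs.inv_simple i
    have hb' : b⁻¹ = b := cs.inv_simple j
    have hflip : b * (a * b) ^ n = ((a * b) ^ n)⁻¹ * b := by
      rw [← inv_pow, mul_inv_rev, ha', hb']
      clear ih
      induction n with
      | zero => simp
      | succ m ihm => rw [pow_succ, ← mul_assoc, ihm, pow_succ]; simp only [mul_assoc]
    have h1 : ((a * b) ^ n * p.1 * ((a * b) ^ n)⁻¹ = b) ↔ p.1 = b * (a * b) ^ (2 * n) := by
      rw [two_mul, pow_add, ← mul_assoc, hflip, mul_inv_eq_iff_eq_mul, mul_assoc,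
        eq_inv_mul_iff_mul_eq]
    have h2 : (b * ((a * b) ^ n * p.1 * ((a * b) ^ n)⁻¹) * b = a) ↔
        p.1 = b * (a * b) ^ (2 * n + 1) := by
      have e : b * (a * b) ^ (2 * n + 1) = ((a * b) ^ n)⁻¹ * (b * a * b) * (a * b) ^ n := by
        rw [show 2 * n + 1 = n + (1 + n) by ring, pow_add, pow_add, pow_one, ← mul_assoc, hflip]
        simp only [mul_assoc]
      rw [e]
      have hab : ∀ y, b * y * b = a ↔ y = b * a * b := fun y => by
        rw [← hb', mul_inv_eq_iff_eq_mul, ← eq_inv_mul_iff_mul_eq, inv_inv, hb', mul_assoc]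
      rw [hab, mul_inv_eq_iff_eq_mul, ← eq_inv_mul_iff_mul_eq, mul_assoc _ (b * a * b)]
    simp only [signedConj, ← ha, ← hb, h1, h2]
    rw [show 2 * (n + 1) = 2 * n + 1 + 1 by ring, Finset.sum_range_succ, Finset.sum_range_succ]
    refine Prod.ext ?_ ?_
    · simp only [pow_succ', mul_inv_rev, ha', hb', mul_assoc]
    · simp only [add_assoc]

theorem isLiftable_signedConj (cs : CoxeterSystem M W) : M.IsLiftable cs.signedConj := by
  intro i j
  funext p
  have hzero : ∀ x : ZMod 2, x + x = 0 := by decide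
  rw [signedConj_mul_pow_apply, two_mul, Finset.sum_range_add]
  simp only [pow_add, cs.simple_mul_simple_pow, one_mul, hzero, inv_one, mul_one, add_zero]
  rfl

/-- The action of `W` on signed elements extending `signedConj`. -/
noncomputable def signedAction (cs : CoxeterSystem M W) : W →* Function.End (W × ZMod 2) :=
  cs.lift ⟨cs.signedConj, cs.isLiftable_signedConj⟩

/-- The parity of the number of occurrences of `t` in the right inversion sequence of any
word for `w`. -/
noncomputable def inversionParity (cs : CoxeterSystem M W) (w t : W) : ZMod 2 :=
  (cs.signedAction w (t, 0)).2

theorem signedAction_simple (cs : CoxeterSystem M W) (i : B) :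
    cs.signedAction (cs.simple i) = cs.signedConj i :=
  cs.lift_apply_simple _ i

theorem signedAction_apply (cs : CoxeterSystem M W) (w t : W) (e : ZMod 2) :
    cs.signedAction w (t, e) = (w * t * w⁻¹, e + cs.inversionParity w t) := by
  unfold inversionParity
  induction w using cs.simple_induction_left generalizing e with
  | one =>
    rw [map_one]
    change (t, e) = (_, e + 0)
    simp
  | mul_simple_left w i ih =>
    have h : ∀ e, cs.signedAction (cs.simple i * w) (t, e) =
        cs.signedConj i (cs.signedAction w (t, e)) := fun e => by
      rw [map_mul, signedAction_simple]; rfl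
    rw [h, h, ih e, ih 0]
    simp [signedConj, mul_assoc, add_assoc]

theorem inversionParity_one (cs : CoxeterSystem M W) (t : W) : cs.inversionParity 1 t = 0 := by
  rw [inversionParity, map_one]; rfl

theorem inversionParity_mul (cs : CoxeterSystem M W) (v w t : W) :
    cs.inversionParity (v * w) t =
      cs.inversionParity w t + cs.inversionParity v (w * t * w⁻¹) := by
  have h : cs.signedAction (v * w) (t, 0) = cs.signedAction v (cs.signedAction w (t, 0)) := by
    rw [map_mul]; rfl
  simp only [signedAction_apply, zero_add] at h
  exact congrArg Prod.snd h

theorem inversionParity_simple (cs : CoxeterSystem M W) (i : B) (t : W) :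
    cs.inversionParity (cs.simple i) t = if t = cs.simple i then 1 else 0 := by
  simp [inversionParity, signedAction_simple, signedConj]

theorem mem_rightInvSeq_of_inversionParity_ne_zero (cs : CoxeterSystem M W) (ω : List B) (t : W)
    (h : cs.inversionParity (cs.wordProd ω) t ≠ 0) : t ∈ cs.rightInvSeq ω := by
  induction ω with
  | nil => exact absurd (cs.inversionParity_one t) (by simpa using h)
  | cons i ω ih =>
    rw [wordProd_cons, inversionParity_mul, inversionParity_simple] at h
    rw [rightInvSeq, List.mem_cons]
    by_cases ht : cs.wordProd ω * t * (cs.wordProd ω)⁻¹ = cs.simple i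
    · left
      rw [← ht]
      group
    · rw [if_neg ht, add_zero] at h
      exact Or.inr (ih h)

theorem length_mul_lt_of_inversionParity_ne_zero (cs : CoxeterSystem M W) {w t : W}
    (h : cs.inversionParity w t ≠ 0) : cs.length (w * t) < cs.length w := by
  obtain ⟨ω, hω, rfl⟩ := cs.exists_isReduced w
  exact (cs.isRightInversion_of_mem_rightInvSeq hω
    (cs.mem_rightInvSeq_of_inversionParity_ne_zero ω t h)).2

theorem inversionParity_ne_zero_iff (cs : CoxeterSystem M W) (w : W) (i : B) :
    cs.inversionParity w (cs.simple i) ≠ 0 ↔ cs.length (w * cs.simple i) < cs.length w := by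
  refine ⟨cs.length_mul_lt_of_inversionParity_ne_zero, fun h h0 => ?_⟩
  have h1 : cs.inversionParity (w * cs.simple i) (cs.simple i) ≠ 0 := by
    rw [inversionParity_mul, inversionParity_simple]
    simp [h0]
  have h2 := cs.length_mul_lt_of_inversionParity_ne_zero h1
  rw [simple_mul_simple_cancel_right] at h2
  omega

/-- The folding form of the exchange condition. -/
theorem simple_mul_eq_mul_simple (cs : CoxeterSystem M W) {z : W} {i j : B}
    (h₁ : cs.length z < cs.length (cs.simple i * z))
    (h₂ : cs.length (cs.simple i * (z * cs.simple j)) < cs.length (z * cs.simple j)) :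
    cs.simple i * z = z * cs.simple j := by
  have e₁ : cs.inversionParity z⁻¹ (cs.simple i) = 0 := by
    by_contra h
    rw [← ne_eq, inversionParity_ne_zero_iff, ← cs.length_inv (z⁻¹ * _)] at h
    simp only [mul_inv_rev, inv_simple, inv_inv, cs.length_inv] at h
    omega
  have e₂ : cs.inversionParity (cs.simple j * z⁻¹) (cs.simple i) ≠ 0 := by
    rw [inversionParity_ne_zero_iff, ← cs.length_inv (_ * cs.simple i),
      ← cs.length_inv (cs.simple j * _)]
    simpa only [mul_inv_rev, inv_simple, inv_inv] using h₂
  rw [inversionParity_mul, e₁, zero_add, inversionParity_simple] at e₂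
  have h : z⁻¹ * cs.simple i * z⁻¹⁻¹ = cs.simple j := by
    by_contra h
    exact e₂ (if_neg h)
  rw [← h]
  group

end CoxeterSystem

section Roots

variable (cs : CoxeterSystem M W) {u : B}

theorem Hm_eq_compl : Hm cs u = (Hp cs u)ᶜ := by
  ext g
  have := cs.length_simple_mul_ne g u
  simp only [Hm, Hp, Set.mem_ofPred_eq, Set.mem_compl_iff]
  omega

theorem one_mem_Hp : (1 : W) ∈ Hp cs u := by
  simp [Hp]

theorem simple_mul_mem_Hp_iff (g : W) : cs.simple u * g ∈ Hp cs u ↔ g ∉ Hp cs u := by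
  have := cs.length_simple_mul_ne g u
  simp only [Hp, Set.mem_ofPred_eq, CoxeterSystem.simple_mul_simple_cancel_left]
  omega

theorem simple_mul_eq_of_mem_of_notMem {z : W} {i : B} (h₁ : z ∈ Hp cs u)
    (h₂ : z * cs.simple i ∉ Hp cs u) : cs.simple u * z = z * cs.simple i := by
  rw [← Set.mem_compl_iff, ← Hm_eq_compl] at h₂
  exact cs.simple_mul_eq_mul_simple h₁ h₂

theorem mem_Hp_of_mul_simple_mem {g : W} {i : B} (h : g * cs.simple i ∈ Hp cs u)
    (hl : cs.length g < cs.length (g * cs.simple i)) : g ∈ Hp cs u := by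
  simp only [Hp, Set.mem_ofPred_eq, ← mul_assoc] at h ⊢
  have := cs.length_simple_mul g u
  have := cs.length_mul_simple (cs.simple u * g) i
  omega

/-- Induction along reduced galleries in the positive root that start at the identity. -/
theorem Hp_induction {p : W → Prop} (one : p 1)
    (step : ∀ (g : W) (i : B), g ∈ Hp cs u → g * cs.simple i ∈ Hp cs u →
      cs.length g < cs.length (g * cs.simple i) → p g → p (g * cs.simple i))
    (g : W) (hg : g ∈ Hp cs u) : p g := by
  induction hn : cs.length g using Nat.strong_induction_on generalizing g with
  | _ n ih =>
    by_cases h1 : g = 1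
    · exact h1 ▸ one
    · obtain ⟨i, hi⟩ := cs.exists_rightDescent_of_ne_one h1
      have hgi : g * cs.simple i * cs.simple i = g := cs.simple_mul_simple_cancel_right i
      have hl : cs.length (g * cs.simple i) < cs.length (g * cs.simple i * cs.simple i) := by
        rwa [hgi]
      have hg' : g * cs.simple i * cs.simple i ∈ Hp cs u := by rwa [hgi]
      have hm := mem_Hp_of_mul_simple_mem cs hg' hl
      have := step _ i hm hg' hl (ih _ (hn ▸ hi) _ hm rfl)
      rwa [hgi] at this

theorem mul_mem_Hp_of_comm {y : W} (hy : y ∈ Hp cs u) (hc : cs.simple u * y = y * cs.simple u)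
    {g : W} (hg : g ∈ Hp cs u) : y * g ∈ Hp cs u := by
  refine Hp_induction cs (p := fun g => y * g ∈ Hp cs u) (by simpa using hy) ?_ g hg
  intro g i hg hgi _ ih
  by_contra h
  rw [← mul_assoc] at h
  have e := simple_mul_eq_of_mem_of_notMem cs ih h
  rw [← mul_assoc, hc, mul_assoc, mul_assoc, mul_right_inj] at e
  rw [← e, simple_mul_mem_Hp_iff] at hgi
  exact hgi hg

theorem inv_mem_Hp_of_comm {y : W} (hy : y ∈ Hp cs u)
    (hc : cs.simple u * y = y * cs.simple u) : y⁻¹ ∈ Hp cs u := by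
  have h : cs.simple u * y⁻¹ = (y * cs.simple u)⁻¹ := by simp
  rw [Hp, Set.mem_ofPred_eq, h, cs.length_inv, cs.length_inv, ← hc]
  exact hy

theorem mem_Hp_of_smul_ssubset {w : W} {A : Set W} (hA : A = Hp cs u ∨ A = Hm cs u)
    (h : w • A ⊂ Hp cs u) : w ∈ Hp cs u := by
  rcases hA with rfl | rfl
  · exact h.1 (Set.mem_smul_set.2 ⟨1, one_mem_Hp cs, by simp⟩)
  · by_contra hw
    have hu : cs.simple u ∈ Hm cs u := by simp [Hm]
    have hwu : w * cs.simple u ∈ Hp cs u := h.1 (Set.mem_smul_set.2 ⟨_, hu, rfl⟩)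
    have hwuu : w * cs.simple u * cs.simple u = w := cs.simple_mul_simple_cancel_right u
    have hc := simple_mul_eq_of_mem_of_notMem cs hwu (i := u) (by rwa [hwuu])
    refine h.2 fun g hg => Set.mem_smul_set.2 ⟨w⁻¹ * g, ?_, by simp⟩
    have hk := mul_mem_Hp_of_comm cs (inv_mem_Hp_of_comm cs hwu hc) (y := (w * cs.simple u)⁻¹)
      (show Commute (cs.simple u) (w * cs.simple u) from hc).inv_right.eq hg
    rw [mul_inv_rev, cs.inv_simple, mul_assoc, simple_mul_mem_Hp_iff] at hk
    rwa [Hm_eq_compl]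

theorem notMem_Hp_of_ssubset_smul {w : W} {A : Set W} (hA : A = Hp cs u ∨ A = Hm cs u)
    (h : Hp cs u ⊂ w • A) : w ∉ Hp cs u := by
  intro hw
  rcases hA with rfl | rfl
  · by_cases hwu : w * cs.simple u ∈ Hp cs u
    · have := h.1 hwu
      rw [Set.mem_smul_set_iff_inv_smul_mem] at this
      simp [Hp] at this
    · have hc := simple_mul_eq_of_mem_of_notMem cs hw hwu
      refine h.2 ?_
      rintro _ ⟨g, hg, rfl⟩
      exact mul_mem_Hp_of_comm cs hw hc hg
  · have := h.1 hw
    rw [Set.mem_smul_set_iff_inv_smul_mem] at this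
    simp [Hm] at this

/-- A wall that separates two adjacent chambers of the positive root, and also separates the
identity side from a chamber of the negative root, meets the interior of the negative root. -/
theorem exists_notMem_Hp_of_fold {x v : W} {i : B} (hx : x ∈ Hp cs u)
    (hxi : x * cs.simple i ∈ Hp cs u) (hl : cs.length x < cs.length (x * cs.simple i))
    (hv : v ∉ Hp cs i) (hxv : x * v ∉ Hp cs u) :
    ∃ z, z ∉ Hp cs u ∧ x * cs.simple i * x⁻¹ * z ∉ Hp cs u := by
  by_contra! hno
  have key : ∀ h ∈ Hp cs u, x⁻¹ * (cs.simple u * h) ∈ Hp cs i := by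
    refine Hp_induction cs ?_ ?_
    · have e₁ : x⁻¹ * (cs.simple u * 1) = (cs.simple u * x)⁻¹ := by simp
      have e₂ : cs.simple i * (cs.simple u * x)⁻¹ = (cs.simple u * (x * cs.simple i))⁻¹ := by
        simp [mul_assoc]
      rw [e₁, Hp, Set.mem_ofPred_eq, e₂, cs.length_inv, cs.length_inv]
      simp only [Hp, Set.mem_ofPred_eq] at hx hxi
      have := cs.length_simple_mul x u
      omega
    · intro g j hg hgj _ ih
      by_contra hc
      rw [← mul_assoc (cs.simple u), ← mul_assoc] at hc
      have e := simple_mul_eq_of_mem_of_notMem cs ih hc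
      have hz : cs.simple u * g ∉ Hp cs u := by
        rwa [← simple_mul_mem_Hp_iff, CoxeterSystem.simple_mul_simple_cancel_left]
      have h := hno _ hz
      rw [mul_assoc, mul_assoc x, e, mul_assoc x⁻¹, mul_inv_cancel_left, mul_assoc,
        simple_mul_mem_Hp_iff] at h
      exact h hgj
  have := key (cs.simple u * (x * v)) ((simple_mul_mem_Hp_iff cs _).2 hxv)
  simp only [CoxeterSystem.simple_mul_simple_cancel_left, inv_mul_cancel_left] at this
  exact hv this

/-- An involution preserves a root satisfying the nested condition as soon as it maps some
element of each of the two opposite roots into the same root. -/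
theorem smul_Hp_eq_of_nestedAt {r : W} (hr : r * r = 1) (hn : NestedAt cs u r)
    {x z : W} (hx : x ∈ Hp cs u) (hrx : r * x ∈ Hp cs u)
    (hz : z ∉ Hp cs u) (hrz : r * z ∉ Hp cs u) : r • Hp cs u = Hp cs u := by
  have inv : ∀ A : Set W, r • r • A = A := fun A => by rw [smul_smul, hr, one_smul]
  have no_ssubset : ∀ A : Set W, ¬ r • A ⊂ A := fun A h =>
    h.2 (by simpa only [inv] using Set.smul_set_mono (a := r) h.1)
  have hrx' : r * x ∈ r • Hp cs u := Set.smul_mem_smul_set hx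
  have hrz' : r * z ∈ r • Hm cs u := Set.smul_mem_smul_set (Hm_eq_compl cs ▸ hz)
  rcases hn with h | h | h | h | h | h
  · exact h
  · rw [h, Hm_eq_compl] at hrx'
    exact absurd hrx hrx'
  · exact absurd h (no_ssubset _)
  · have := h.1 hrx'
    rw [Hm_eq_compl] at this
    exact absurd hrx this
  · exact absurd (h.1 hrz') hrz
  · exact absurd h (no_ssubset _)

end Roots

theorem IsBuilding.dist_isom_mul_simple {cs : CoxeterSystem M W} {Δ : Type*} {d : Δ → Δ → W}
    (hb : IsBuilding cs Δ d) {φ : W → Δ} (hφ : IsIsom d φ) (x : W) (i : B) (E : Δ) :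
    d (φ (x * cs.simple i)) E = cs.simple i * d (φ x) E ∨
      d (φ (x * cs.simple i)) E = d (φ x) E ∧ d (φ x) E ∉ Hp cs i := by
  obtain ⟨h, h'⟩ := hb.2.2.1 (φ x) E (φ (x * cs.simple i)) i (by simp [hφ _ _])
  by_cases hp : d (φ x) E ∈ Hp cs i
  · exact Or.inl (h' hp)
  · exact h.imp_right fun h => ⟨h, hp⟩

/-- Transitivity of root inclusions in a building satisfying the nested condition, case (i). -/
theorem root_inclusion_transitivity_pos (cs : CoxeterSystem M W) (u : B) (hnest : Nested cs u)
    {Δ : Type*} (d : Δ → Δ → W) (hb : IsBuilding cs Δ d)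
    (φ φ₁ φ₂ : W → Δ) (hφ : IsIsom d φ) (hφ₁ : IsIsom d φ₁) (hφ₂ : IsIsom d φ₂)
    (C D E : Δ) (w w₁ w₂ : W)
    (hD : φ 1 = D) (hD₁ : φ₁ 1 = D) (hC : φ w = C) (hE₁ : φ₁ w₁ = E)
    (hC₂ : φ₂ 1 = C) (hE₂ : φ₂ w₂ = E)
    (A A' : Set W) (hA : A = Hp cs u ∨ A = Hm cs u) (hA' : A' = Hp cs u ∨ A' = Hm cs u)
    (h₁ : w • A ⊂ Hp cs u) (h₂ : Hp cs u ⊂ w₁ • A') :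
    A ⊂ w₂ • A' := by
  subst hD hC
  have hw₁ : d (φ 1) E = w₁ := by rw [← hD₁, ← hE₁, hφ₁]; simp
  have hw₂ : d (φ w) E = w₂ := by rw [← hC₂, ← hE₂, hφ₂]; simp
  have key : ∀ x ∈ Hp cs u, Hp cs u ⊂ (x * d (φ x) E) • A' := by
    refine Hp_induction cs ?_ ?_
    · rwa [hw₁, one_mul]
    · intro x i hx hxi hl ih
      rcases hb.dist_isom_mul_simple hφ x i E with h | ⟨h, hv⟩
      · rwa [h, mul_assoc, CoxeterSystem.simple_mul_simple_cancel_left]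
      · obtain ⟨z, hz, hrz⟩ := exists_notMem_Hp_of_fold cs hx hxi hl hv
          (notMem_Hp_of_ssubset_smul cs hA' ih)
        have hr := smul_Hp_eq_of_nestedAt cs (r := x * cs.simple i * x⁻¹)
          (by simp [mul_assoc]) (hnest _) hx (by simpa using hxi) hz hrz
        have hs : (x * cs.simple i * x⁻¹) • Hp cs u ⊂
            (x * cs.simple i * x⁻¹) • (x * d (φ x) E) • A' :=
          ⟨Set.smul_set_mono ih.1, fun h' => ih.2 (Set.smul_set_subset_smul_set_iff.1 h')⟩
        rw [hr, smul_smul] at hs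
        simpa [h, mul_assoc] using hs
  have h := h₁.trans (key w (mem_Hp_of_smul_ssubset cs hA h₁))
  rw [hw₂, ← smul_smul] at h
  exact ⟨Set.smul_set_subset_smul_set_iff.1 h.1, fun h' => h.2 (Set.smul_set_mono h')⟩
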